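/- Let α ∈ (0,1) and let g : (0,∞) → ℝ be such that g and y ↦ y·g(y) belong to L¹(0,∞) and g has compact support. Then for all t > 1, ‖v^+(·,t) − m·𝔈_t(·)‖_{L^∞(0,∞)} ≤ C_2(α)·t^{−2/(1+α)}·‖y g(y)‖_{L¹(0,∞)} and ‖v^−(·,t) − m·𝔈_t(·)‖_{L^∞(0,∞)} ≤ C_2(α)·t^{−2/(1+α)}·‖y g(y)‖_{L¹(0,∞)}, where C_2(α) = 2 a_0 C_1(α). -/

import Mathlib

open Real MeasureTheory Set Filter Topology

noncomputable def bCoef (α : ℝ) (n : ℕ) : ℝ :=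
  ∏ i ∈ Finset.range n, Real.Gamma (α * i + i + 2) / Real.Gamma (α * (i + 1) + i + 2)

/-- The profile function `Φ(x) = ∑ bₙ (−x^{1+α}/(1+α))ⁿ`. -/
noncomputable def Phi (α : ℝ) (x : ℝ) : ℝ :=
  ∑' n : ℕ, bCoef α n * (-(x ^ (1 + α)) / (1 + α)) ^ n

/-- The Caputo fractional derivative of order `α`. -/
noncomputable def caputo (α : ℝ) (f : ℝ → ℝ) (x : ℝ) : ℝ :=
  (1 / Real.Gamma (1 - α)) * ∫ τ in (0:ℝ)..x, deriv f τ * (x - τ) ^ (-α)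

/-- The normalizing constant `a₀` with `1/a₀ = 2∫₀^∞ Φ`. -/
noncomputable def a0 (α : ℝ) : ℝ := (2 * ∫ x in Set.Ioi (0:ℝ), Phi α x)⁻¹

/-- The fundamental solution `𝔈_t(x) = a₀ t^{−1/(1+α)} Φ(|x| t^{−1/(1+α)})`. -/
noncomputable def fundSol (α t x : ℝ) : ℝ :=
  a0 α * t ^ (-1/(1+α)) * Phi α (|x| * t ^ (-1/(1+α)))

noncomputable def C1 (α : ℝ) : ℝ :=
  α * (2:ℝ) ^ (1+α) * max (∫ u in (1/2:ℝ)..1, u ^ (-(1+α)) * (1-u) ^ (α-1)) 2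

noncomputable def C2 (α : ℝ) : ℝ := 2 * a0 α * C1 α

/-! ### Entire power series -/

/-- Coefficients of an everywhere convergent power series. -/
def Ent (c : ℕ → ℝ) : Prop := ∀ R : ℝ, 0 ≤ R → Summable (fun n => |c n| * R ^ n)

/-- Coefficients of the derivative. -/
def dC (c : ℕ → ℝ) (n : ℕ) : ℝ := (n + 1) * c (n + 1)

/-- Sum of the power series. -/
noncomputable def pS (c : ℕ → ℝ) (z : ℝ) : ℝ := ∑' n, c n * z ^ n

lemma Ent.dC {c : ℕ → ℝ} (h : Ent c) : Ent (dC c) := by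
  intro R hR
  have h1 := (summable_nat_add_iff 1).2 (h (2 * (R + 1)) (by positivity))
  refine Summable.of_nonneg_of_le (fun n => by positivity) (fun n => ?_) h1
  have h2 : ((n : ℝ) + 1) ≤ 2 ^ (n + 1) := by
    have := (Nat.lt_two_pow_self (n := n + 1)).le
    exact_mod_cast this
  have h3 : R ^ n ≤ (R + 1) ^ (n + 1) :=
    (pow_le_pow_left₀ hR (by linarith) n).trans (pow_le_pow_right₀ (by linarith) (by omega))
  have h4 : |_root_.dC c n| = ((n : ℝ) + 1) * |c (n + 1)| := by
    rw [_root_.dC, abs_mul, abs_of_pos (by positivity)]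
  rw [h4, mul_pow]
  calc ((n : ℝ) + 1) * |c (n + 1)| * R ^ n = |c (n + 1)| * (((n : ℝ) + 1) * R ^ n) := by ring
    _ ≤ _ := by gcongr

lemma Ent.summable {c : ℕ → ℝ} (h : Ent c) (z : ℝ) : Summable (fun n => c n * z ^ n) := by
  refine Summable.of_norm ?_
  simpa [abs_mul, abs_pow] using h |z| (abs_nonneg z)

lemma Ent.hasDerivAt {c : ℕ → ℝ} (h : Ent c) (z : ℝ) :
    HasDerivAt (pS c) (pS (_root_.dC c) z) z := by
  set r := |z| + 1 with hr
  have hr0 : 0 ≤ r := by positivity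
  have hu : Summable (fun n : ℕ => |c n| * (n * r ^ (n - 1))) := by
    refine (summable_nat_add_iff 1).1 ?_
    refine (h.dC r hr0).congr (fun n => ?_)
    rw [_root_.dC, abs_mul, abs_of_pos (by positivity)]
    push_cast
    ring
  have key := hasDerivAt_tsum_of_isPreconnected (𝕜 := ℝ) (F := ℝ) (t := Metric.ball (0 : ℝ) r)
    (g := fun n z => c n * z ^ n)
    (g' := fun n z => c n * (n * z ^ (n - 1))) (y₀ := 0) (y := z) hu Metric.isOpen_ball
    (convex_ball 0 r).isPreconnected
    (fun n y _ => (hasDerivAt_pow n y).const_mul (c n))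
    (fun n y hy => by
      have : |y| ≤ r := by
        have := Metric.mem_ball.1 hy
        rw [Real.dist_eq, sub_zero] at this
        exact this.le
      rw [norm_mul, norm_mul, norm_pow, Real.norm_eq_abs, Real.norm_eq_abs, Real.norm_eq_abs,
        abs_of_nonneg (Nat.cast_nonneg n : (0 : ℝ) ≤ n)]
      gcongr)
    (by simp [hr]; positivity) (h.summable 0) (by simp [hr])
  refine key.congr_deriv ?_
  have hs : Summable (fun n : ℕ => c n * (n * z ^ (n - 1))) := by
    refine (summable_nat_add_iff 1).1 ?_
    refine (h.dC.summable z).congr (fun n => ?_)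
    rw [_root_.dC]
    push_cast
    ring
  rw [hs.tsum_eq_zero_add, pS]
  simp only [Nat.cast_zero, zero_mul, mul_zero, zero_add]
  refine tsum_congr (fun n => ?_)
  rw [_root_.dC]
  push_cast
  ring

/-! ### The coefficients of the profile -/

/-- Coefficients of the profile as a power series in `x^{1+α}`. -/
noncomputable def cC (α : ℝ) (n : ℕ) : ℝ := bCoef α n * (-1 / (1 + α)) ^ n

lemma Phi_eq (α x : ℝ) : Phi α x = pS (cC α) (x ^ (1 + α)) := by
  rw [Phi, pS]
  refine tsum_congr (fun n => ?_)
  rw [cC, mul_assoc, ← mul_pow]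
  congr 2
  ring

/-- The Gamma ratio. -/
noncomputable def rC (α : ℝ) (n : ℕ) : ℝ :=
  Real.Gamma (α * n + n + 2) / Real.Gamma (α * (n + 1) + n + 2)

lemma bCoef_succ (α : ℝ) (n : ℕ) : bCoef α (n + 1) = bCoef α n * rC α n := by
  rw [bCoef, Finset.prod_range_succ, ← bCoef, rC]

lemma rC_pos {α : ℝ} (h0 : 0 < α) (n : ℕ) : 0 < rC α n :=
  div_pos (Real.Gamma_pos_of_pos (by positivity)) (Real.Gamma_pos_of_pos (by positivity))

lemma rC_le_one {α : ℝ} (h0 : 0 < α) (n : ℕ) : rC α n ≤ 1 := by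
  rw [rC, div_le_one (Real.Gamma_pos_of_pos (by positivity))]
  apply Real.Gamma_strictMonoOn_Ici.monotoneOn
  · simp only [mem_Ici]
    have : 0 ≤ α * n + n := by positivity
    linarith
  · simp only [mem_Ici]
    have : 0 ≤ α * (n + 1) + n := by positivity
    linarith
  · linarith

lemma rC_le {α : ℝ} (h0 : 0 < α) (h1 : α < 1) (n : ℕ) : rC α n ≤ 2 * ((n : ℝ) + 1) ^ (-α) := by
  set y : ℝ := α * n + n + 2 with hy
  have hn : (0 : ℝ) ≤ n := Nat.cast_nonneg n
  have hyn : (n : ℝ) + 1 ≤ y := by nlinarith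
  have hy1 : 1 < y := by nlinarith
  have hy0 : 0 < y := by linarith
  have e : α * ((n : ℝ) + 1) + n + 2 = y + α := by rw [hy]; ring
  rw [rC, e, ← hy]
  have hG : 0 < Real.Gamma (y + α) := Real.Gamma_pos_of_pos (by linarith)
  have hlc := Real.Gamma_mul_add_mul_le_rpow_Gamma_mul_rpow_Gamma (s := y + α) (t := y + α + 1)
    (a := α) (b := 1 - α) (by linarith) (by linarith) h0 (by linarith) (by ring)
  have e2 : α * (y + α) + (1 - α) * (y + α + 1) = y + 1 := by ring
  rw [e2, Real.Gamma_add_one hy0.ne', Real.Gamma_add_one (by linarith),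
    Real.mul_rpow (by linarith) hG.le, mul_left_comm, ← Real.rpow_add hG] at hlc
  rw [show α + (1 - α) = 1 by ring, Real.rpow_one] at hlc
  have h3 : (y + α) ^ (1 - α) ≤ 2 * (y ^ (-α) * y) := by
    calc (y + α) ^ (1 - α) ≤ (2 * y) ^ (1 - α) :=
          Real.rpow_le_rpow (by linarith) (by linarith) (by linarith)
      _ = 2 ^ (1 - α) * y ^ (1 - α) := Real.mul_rpow (by norm_num) hy0.le
      _ ≤ 2 * y ^ (1 - α) := by
          gcongr
          calc (2 : ℝ) ^ (1 - α) ≤ 2 ^ (1 : ℝ) :=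
                Real.rpow_le_rpow_of_exponent_le (by norm_num) (by linarith)
            _ = 2 := Real.rpow_one 2
      _ = _ := by
          rw [show (1 - α) = -α + 1 by ring, Real.rpow_add hy0, Real.rpow_one]
  have h4 : y ^ (-α) ≤ ((n : ℝ) + 1) ^ (-α) :=
    Real.rpow_le_rpow_of_nonpos (by positivity) hyn (by linarith)
  rw [div_le_iff₀ hG]
  have h5 : y * Real.Gamma y ≤ y * (2 * y ^ (-α) * Real.Gamma (y + α)) := by
    calc _ ≤ _ := hlc
      _ ≤ (2 * (y ^ (-α) * y)) * Real.Gamma (y + α) := by gcongr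
      _ = _ := by ring
  have h6 := le_of_mul_le_mul_left h5 hy0
  refine h6.trans ?_
  gcongr

lemma rC_tendsto {α : ℝ} (h0 : 0 < α) (h1 : α < 1) : Tendsto (rC α) atTop (𝓝 0) := by
  have h2 : Tendsto (fun n : ℕ => 2 * ((n : ℝ) + 1) ^ (-α)) atTop (𝓝 (2 * 0)) := by
    refine Tendsto.const_mul 2 ?_
    exact (tendsto_rpow_neg_atTop h0).comp
      (tendsto_atTop_add_const_right _ 1 tendsto_natCast_atTop_atTop)
  rw [mul_zero] at h2
  exact squeeze_zero (fun n => (rC_pos h0 n).le) (rC_le h0 h1) h2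

lemma bCoef_pos {α : ℝ} (h0 : 0 < α) (n : ℕ) : 0 < bCoef α n := by
  induction n with
  | zero => simp [bCoef]
  | succ k ih => rw [bCoef_succ]; exact mul_pos ih (rC_pos h0 k)

lemma bCoef_le_one {α : ℝ} (h0 : 0 < α) (n : ℕ) : bCoef α n ≤ 1 := by
  induction n with
  | zero => simp [bCoef]
  | succ k ih =>
    rw [bCoef_succ]
    exact mul_le_one₀ ih (rC_pos h0 k).le (rC_le_one h0 k)

lemma cC_succ (α : ℝ) (n : ℕ) : cC α (n + 1) = -(cC α n * rC α n / (1 + α)) := by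
  rw [cC, cC, bCoef_succ, pow_succ]; ring

lemma cC_ne {α : ℝ} (h0 : 0 < α) (n : ℕ) : cC α n ≠ 0 := by
  rw [cC]
  have := (bCoef_pos h0 n).ne'
  have h : (-1 / (1 + α)) ≠ 0 := div_ne_zero (by norm_num) (by linarith)
  positivity

lemma cC_ent {α : ℝ} (h0 : 0 < α) (h1 : α < 1) : Ent (cC α) := by
  intro R hR
  rcases hR.eq_or_lt with rfl | hR
  · exact summable_of_ne_finset_zero (s := {0}) (fun n hn => by
      have : n ≠ 0 := by simpa using hn
      simp [this])
  refine summable_of_ratio_test_tendsto_lt_one (l := 0) zero_lt_one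
    (Eventually.of_forall fun n => mul_ne_zero (abs_ne_zero.2 (cC_ne h0 n)) (by positivity)) ?_
  have h2 : Tendsto (fun n => rC α n * (R / (1 + α))) atTop (𝓝 (0 * (R / (1 + α)))) :=
    (rC_tendsto h0 h1).mul_const _
  rw [zero_mul] at h2
  refine h2.congr (fun n => ?_)
  have hc : 0 < |cC α n| := abs_pos.2 (cC_ne h0 n)
  rw [cC_succ, abs_neg, abs_div, abs_mul, abs_of_pos (rC_pos h0 n),
    abs_of_pos (show 0 < 1 + α by linarith), Real.norm_eq_abs, Real.norm_eq_abs, abs_mul, abs_mul,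
    abs_div, abs_mul, abs_abs, abs_of_pos (rC_pos h0 n), abs_of_pos (show 0 < 1 + α by linarith),
    abs_of_pos (pow_pos hR _), abs_of_pos (pow_pos hR _), pow_succ]
  field_simp

lemma cC_abs_le {α : ℝ} (h0 : 0 < α) (n : ℕ) : (1 + α) * |cC α (n + 1)| ≤ 1 := by
  have ha : 0 < 1 + α := by linarith
  rw [cC, abs_mul, abs_of_pos (bCoef_pos h0 _), abs_pow, abs_div, abs_neg, abs_one,
    abs_of_pos ha, pow_succ]
  have h2 : (1 / (1 + α)) ^ n ≤ 1 := pow_le_one₀ (by positivity) (by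
    rw [div_le_one ha]; linarith)
  have h3 := bCoef_le_one h0 (n + 1)
  calc _ = bCoef α (n + 1) * (1 / (1 + α)) ^ n := by field_simp
    _ ≤ 1 := mul_le_one₀ h3 (by positivity) h2

/-! ### Fractional kernel -/

lemma kernel_integrable {α x : ℝ} (h1 : α < 1) {a b : ℝ} {f : ℝ → ℝ}
    (hf : ContinuousOn f (uIcc a b)) :
    IntervalIntegrable (fun s => (x - s) ^ (-α) * f s) volume a b := by
  refine IntervalIntegrable.mul_continuousOn ?_ hf
  have h := (intervalIntegral.intervalIntegrable_rpow' (a := x - a) (b := x - b) (r := -α)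
    (by linarith)).comp_sub_left (c := x)
  simpa using h

lemma kernel_const {α x : ℝ} (h1 : α < 1) (c : ℝ) :
    ∫ s in (0:ℝ)..x, (x - s) ^ (-α) * c = c * x ^ (1 - α) / (1 - α) := by
  rw [intervalIntegral.integral_mul_const,
    intervalIntegral.integral_comp_sub_left (fun s => s ^ (-α)) x, sub_self, sub_zero,
    integral_rpow (Or.inl (by linarith)), Real.zero_rpow (by linarith),
    show -α + 1 = 1 - α by ring]
  ring

lemma frac_lemma {α x0 d φ' : ℝ} (h0 : 0 < α) (h1 : α < 1) (hx0 : 0 < x0) {φ P : ℝ → ℝ}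
    (hc : ContinuousOn φ (Icc 0 x0)) (hpos : ∀ s ∈ Ioo 0 x0, 0 ≤ φ s)
    (hd : HasDerivAt φ φ' x0) (hz : φ x0 = 0)
    (hP : ∀ x ∈ Ioc 0 x0, P x = ∫ s in (0:ℝ)..x, (x - s) ^ (-α) * φ s)
    (hPd : HasDerivAt P d x0) : d ≤ 0 := by
  obtain ⟨L, hL0, hL⟩ := hd.isBigO_sub.exists_pos
  rw [Asymptotics.isBigOWith_iff] at hL
  obtain ⟨δ, hδ, hball⟩ := Metric.eventually_nhds_iff.1 hL
  have hlip : ∀ s, x0 - δ < s → s ≤ x0 → |φ s| ≤ L * (x0 - s) := by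
    intro s hs hs'
    have := hball (y := s) (by rw [Real.dist_eq, abs_lt]; constructor <;> linarith)
    rw [hz, sub_zero, Real.norm_eq_abs, Real.norm_eq_abs, abs_sub_comm,
      abs_of_nonneg (sub_nonneg.2 hs')] at this
    exact this
  have hslope : Tendsto (slope P x0) (𝓝[<] x0) (𝓝 d) :=
    (hasDerivAt_iff_tendsto_slope.1 hPd).mono_left (nhdsWithin_mono _ (fun y hy => ne_of_lt hy))
  have hlim : Tendsto (fun x => L * (x0 - x) ^ (1 - α)) (𝓝[<] x0) (𝓝 0) := by
    have h2 : Continuous (fun x : ℝ => L * (x0 - x) ^ (1 - α)) :=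
      continuous_const.mul ((continuous_const.sub continuous_id).rpow_const
        (fun x => Or.inr (by linarith)))
    have h3 := (h2.tendsto x0).mono_left (nhdsWithin_le_nhds (s := Iio x0))
    simpa [Real.zero_rpow (show (1 - α) ≠ 0 by linarith)] using h3
  refine le_of_tendsto_of_tendsto hslope hlim ?_
  have hnear : ∀ᶠ x in 𝓝[<] x0, x ∈ Ioo (max 0 (x0 - δ)) x0 :=
    Ioo_mem_nhdsLT (max_lt hx0 (by linarith))
  filter_upwards [hnear] with x hx
  have hx1 : 0 < x := (le_max_left _ _).trans_lt hx.1
  have hx2 : x0 - δ < x := (le_max_right _ _).trans_lt hx.1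
  have hx3 : x < x0 := hx.2
  have hI1 : IntervalIntegrable (fun s => (x0 - s) ^ (-α) * φ s) volume 0 x :=
    kernel_integrable h1 (hc.mono (by rw [uIcc_of_le hx1.le]; exact Icc_subset_Icc_right hx3.le))
  have hI2 : IntervalIntegrable (fun s => (x0 - s) ^ (-α) * φ s) volume x x0 :=
    kernel_integrable h1 (hc.mono (by rw [uIcc_of_le hx3.le]; exact Icc_subset_Icc_left hx1.le))
  have hI3 : IntervalIntegrable (fun s => (x - s) ^ (-α) * φ s) volume 0 x :=
    kernel_integrable h1 (hc.mono (by rw [uIcc_of_le hx1.le]; exact Icc_subset_Icc_right hx3.le))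
  have hle : ∫ s in (0:ℝ)..x, (x0 - s) ^ (-α) * φ s ≤ ∫ s in (0:ℝ)..x, (x - s) ^ (-α) * φ s := by
    refine intervalIntegral.integral_mono_on_of_le_Ioo hx1.le hI1 hI3 (fun s hs => ?_)
    have := hpos s ⟨hs.1, hs.2.trans hx3⟩
    refine mul_le_mul_of_nonneg_right ?_ this
    exact Real.rpow_le_rpow_of_nonpos (by linarith [hs.2]) (by linarith) (by linarith)
  have hbd : ‖∫ s in x..x0, (x0 - s) ^ (-α) * φ s‖ ≤ L * (x0 - x) ^ (1 - α) * |x0 - x| := by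
    refine intervalIntegral.norm_integral_le_of_norm_le_const (fun s hs => ?_)
    rw [uIoc_of_le hx3.le] at hs
    have h3 := hlip s (by linarith [hs.1]) hs.2
    rcases hs.2.eq_or_lt with rfl | hlt
    · rw [hz, mul_zero, norm_zero]
      have : 0 ≤ s - x := by linarith
      positivity
    have h4 : 0 < x0 - s := by linarith
    rw [norm_mul, Real.norm_eq_abs, Real.norm_eq_abs, abs_of_pos (Real.rpow_pos_of_pos h4 _)]
    calc (x0 - s) ^ (-α) * |φ s| ≤ (x0 - s) ^ (-α) * (L * (x0 - s)) := by gcongr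
      _ = L * (x0 - s) ^ (1 - α) := by
        rw [show 1 - α = -α + 1 by ring, Real.rpow_add h4, Real.rpow_one]; ring
      _ ≤ _ := by
        refine mul_le_mul_of_nonneg_left ?_ hL0.le
        exact Real.rpow_le_rpow h4.le (by linarith [hs.1]) (by linarith)
  have hlt : 0 < x0 - x := by linarith
  rw [abs_of_pos hlt] at hbd
  have hbd' := (le_abs_self _).trans hbd
  have hmain : P x0 - P x ≤ L * (x0 - x) ^ (1 - α) * (x0 - x) := by
    rw [hP x0 ⟨hx0, le_rfl⟩, hP x ⟨hx1, hx3.le⟩,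
      ← intervalIntegral.integral_add_adjacent_intervals hI1 hI2]
    linarith
  rw [slope_comm, slope_def_field, div_le_iff₀ hlt]
  exact hmain

lemma beta_kernel {a u : ℝ} (ha : 0 < a) (hu : 0 < u) {x : ℝ} (hx : 0 < x) :
    ∫ s in (0:ℝ)..x, (x - s) ^ (a - 1) * s ^ (u - 1) =
      x ^ (u + a - 1) * (Real.Gamma u * Real.Gamma a / Real.Gamma (u + a)) := by
  have h := Complex.betaIntegral_scaled (u : ℂ) (a : ℂ) hx
  rw [Complex.betaIntegral_eq_Gamma_mul_div _ _ (by simpa) (by simpa)] at h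
  have e : ∫ s in (0:ℝ)..x, (s : ℂ) ^ ((u : ℂ) - 1) * ((x : ℂ) - s) ^ ((a : ℂ) - 1) =
      ∫ s in (0:ℝ)..x, (((x - s) ^ (a - 1) * s ^ (u - 1) : ℝ) : ℂ) := by
    refine intervalIntegral.integral_congr (fun s hs => ?_)
    rw [uIcc_of_le hx.le] at hs
    push_cast
    rw [Complex.ofReal_cpow (by linarith [hs.2]), Complex.ofReal_cpow hs.1]
    push_cast
    ring
  rw [e, intervalIntegral.integral_ofReal, ← Complex.ofReal_add, Complex.Gamma_ofReal,
    Complex.Gamma_ofReal, Complex.Gamma_ofReal] at h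
  apply Complex.ofReal_injective
  rw [h]
  push_cast
  rw [Complex.ofReal_cpow hx.le]
  push_cast
  rfl

/-! ### The derivative of the profile -/

/-- Minus the derivative of the profile. -/
noncomputable def Psi (α x : ℝ) : ℝ := -((1 + α) * x ^ α * pS (dC (cC α)) (x ^ (1 + α)))

lemma Psi_continuous {α : ℝ} (h0 : 0 < α) (h1 : α < 1) : Continuous (Psi α) := by
  have h2 : Continuous (pS (dC (cC α))) :=
    continuous_iff_continuousAt.2 fun z => ((cC_ent h0 h1).dC.hasDerivAt z).continuousAt
  have h3 : Continuous (fun x : ℝ => x ^ α) := Real.continuous_rpow_const h0.le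
  have h4 : Continuous (fun x : ℝ => x ^ (1 + α)) := Real.continuous_rpow_const (by linarith)
  exact ((continuous_const.mul h3).mul (h2.comp h4)).neg

lemma Phi_continuous {α : ℝ} (h0 : 0 < α) (h1 : α < 1) : Continuous (Phi α) := by
  have h2 : Continuous (pS (cC α)) :=
    continuous_iff_continuousAt.2 fun z => ((cC_ent h0 h1).hasDerivAt z).continuousAt
  have h4 : Continuous (fun x : ℝ => x ^ (1 + α)) := Real.continuous_rpow_const (by linarith)
  have := h2.comp h4
  refine this.congr (fun x => (Phi_eq α x).symm)

lemma Phi_hasDerivAt {α : ℝ} (h0 : 0 < α) (h1 : α < 1) {x : ℝ} (hx : 0 < x) :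
    HasDerivAt (Phi α) (-Psi α x) x := by
  have h2 := (Real.hasDerivAt_rpow_const (x := x) (p := 1 + α) (Or.inl hx.ne'))
  have h3 := ((cC_ent h0 h1).hasDerivAt (x ^ (1 + α))).comp x h2
  have h4 : Phi α = pS (cC α) ∘ fun x => x ^ (1 + α) := funext (fun x => Phi_eq α x)
  rw [h4]
  refine h3.congr_deriv ?_
  rw [Psi, show 1 + α - 1 = α by ring]
  ring

lemma Psi_hasDerivAt {α : ℝ} (h0 : 0 < α) (h1 : α < 1) {x : ℝ} (hx : 0 < x) :
    ∃ d, HasDerivAt (Psi α) d x := by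
  have h2 := (Real.hasDerivAt_rpow_const (x := x) (p := 1 + α) (Or.inl hx.ne'))
  have h3 := ((cC_ent h0 h1).dC.hasDerivAt (x ^ (1 + α))).comp x h2
  have h4 := (Real.hasDerivAt_rpow_const (x := x) (p := α) (Or.inl hx.ne'))
  exact ⟨_, ((h4.const_mul (1 + α)).mul h3).neg⟩

lemma Phi_zero {α : ℝ} (h0 : 0 < α) : Phi α 0 = 1 := by
  rw [Phi, tsum_eq_single 0]
  · simp [bCoef]
  · intro n hn
    rw [Real.zero_rpow (by linarith)]
    simp [hn]

lemma Psi_small {α : ℝ} (h0 : 0 < α) {x : ℝ} (hx : 0 ≤ x) (hx4 : x ≤ 1 / 4) :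
    Psi α x ≤ 4 := by
  have hz0 : 0 ≤ x ^ (1 + α) := by positivity
  have hz : x ^ (1 + α) ≤ 1 / 4 := by
    refine le_trans ?_ hx4
    calc x ^ (1 + α) ≤ x ^ (1 : ℝ) :=
          Real.rpow_le_rpow_of_exponent_ge_of_imp hx (by linarith) (by linarith) (by intro _ h; linarith)
      _ = x := Real.rpow_one x
  have hxa : x ^ α ≤ 1 := Real.rpow_le_one hx (by linarith) h0.le
  have hxa0 : 0 ≤ x ^ α := by positivity
  set z := x ^ (1 + α)
  have hg : HasSum (fun n : ℕ => (1 / 2 : ℝ) ^ n) 2 := hasSum_geometric_two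
  have hb := tsum_of_norm_bounded (f := fun n => (1 + α) * (dC (cC α) n * z ^ n)) hg (fun n => by
    rw [Real.norm_eq_abs, abs_mul, abs_mul, dC, abs_mul, abs_of_pos (show 0 < 1 + α by linarith),
      abs_of_pos (show (0 : ℝ) < n + 1 by positivity), abs_of_nonneg (pow_nonneg hz0 n)]
    have h2 : ((n : ℝ) + 1) ≤ 2 ^ n := by
      have := (Nat.lt_two_pow_self (n := n))
      exact_mod_cast this
    calc _ = ((1 + α) * |cC α (n + 1)|) * ((n + 1) * z ^ n) := by ring
      _ ≤ 1 * (2 ^ n * (1 / 4) ^ n) := by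
        have := cC_abs_le h0 n
        gcongr
      _ = (1 / 2) ^ n := by rw [one_mul, ← mul_pow]; norm_num)
  rw [tsum_mul_left, Real.norm_eq_abs] at hb
  have e : Psi α x = x ^ α * (-((1 + α) * pS (dC (cC α)) z)) := by rw [Psi]; ring
  rw [e]
  have h5 : -((1 + α) * pS (dC (cC α)) z) ≤ 2 := (neg_le_abs _).trans hb
  nlinarith

lemma Psi_near_zero {α : ℝ} (h0 : 0 < α) (h1 : α < 1) :
    ∃ δ > 0, ∀ x, 0 < x → x < δ → 0 < Psi α x := by
  have hneg : pS (dC (cC α)) 0 < 0 := by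
    rw [pS, tsum_eq_single 0 (fun n hn => by simp [hn])]
    simp only [dC, Nat.cast_zero, zero_add, pow_zero, mul_one, one_mul]
    rw [show (1 : ℕ) = 0 + 1 from rfl, cC_succ]
    have := rC_pos h0 0
    have h2 : cC α 0 = 1 := by simp [cC, bCoef]
    rw [h2]
    have : 0 < 1 * rC α 0 / (1 + α) := by positivity
    linarith
  have h2 : ContinuousAt (fun x : ℝ => pS (dC (cC α)) (x ^ (1 + α))) 0 := by
    have h3 : Continuous (pS (dC (cC α))) :=
      continuous_iff_continuousAt.2 fun z => ((cC_ent h0 h1).dC.hasDerivAt z).continuousAt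
    have h4 : Continuous (fun x : ℝ => x ^ (1 + α)) := Real.continuous_rpow_const (by linarith)
    exact (h3.comp h4).continuousAt
  have h3 : ∀ᶠ x in 𝓝 (0 : ℝ), pS (dC (cC α)) (x ^ (1 + α)) < 0 := by
    refine h2.eventually_lt_const ?_
    simpa only [Real.zero_rpow (show 1 + α ≠ 0 by linarith)] using hneg
  obtain ⟨δ, hδ, h4⟩ := Metric.eventually_nhds_iff.1 h3
  refine ⟨δ, hδ, fun x hx hx' => ?_⟩
  have h5 := h4 (y := x) (by rwa [Real.dist_eq, sub_zero, abs_of_pos hx])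
  have h6 : 0 < (1 + α) * x ^ α := by positivity
  rw [Psi]
  nlinarith

lemma term_value {α : ℝ} (h0 : 0 < α) (h1 : α < 1) {x : ℝ} (hx : 0 < x) (n : ℕ) :
    (1 + α) * (dC (cC α) n * ∫ s in (0:ℝ)..x, (x - s) ^ (-α) * (s ^ α * (s ^ (1 + α)) ^ n)) =
      -(Real.Gamma (1 - α) / (1 + α) * x * (cC α n * (x ^ (1 + α)) ^ n)) := by
  have hu : 0 < (1 + α) * (n + 1) := by positivity
  have e1 : ∫ s in (0:ℝ)..x, (x - s) ^ (-α) * (s ^ α * (s ^ (1 + α)) ^ n) =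
      ∫ s in (0:ℝ)..x, (x - s) ^ ((1 - α) - 1) * s ^ ((1 + α) * (n + 1) - 1) := by
    refine intervalIntegral.integral_congr (fun s hs => ?_)
    rw [uIcc_of_le hx.le] at hs
    rw [show (1 - α) - 1 = -α by ring]
    congr 1
    rw [← Real.rpow_natCast, ← Real.rpow_mul hs.1, ← Real.rpow_add_of_nonneg hs.1 h0.le (by positivity)]
    congr 1
    ring
  rw [e1, beta_kernel (by linarith) hu hx, dC, cC_succ, rC]
  have e2 : (1 + α) * ((n : ℝ) + 1) + (1 - α) = α * n + n + 2 := by ring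
  have e3 : Real.Gamma (α * (n + 1) + n + 2) =
      ((1 + α) * (n + 1)) * Real.Gamma ((1 + α) * (n + 1)) := by
    rw [← Real.Gamma_add_one hu.ne']
    congr 1
    ring
  have e4 : x ^ ((1 + α) * ((n : ℝ) + 1) + (1 - α) - 1) = x * (x ^ (1 + α)) ^ n := by
    rw [← Real.rpow_natCast, ← Real.rpow_mul hx.le]
    nth_rewrite 2 [← Real.rpow_one x]
    rw [← Real.rpow_add hx]
    congr 1
    ring
  rw [e4, e2, e3]
  have g1 : 0 < Real.Gamma ((1 + α) * (n + 1)) := Real.Gamma_pos_of_pos hu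
  have g2 : 0 < Real.Gamma (α * n + n + 2) := Real.Gamma_pos_of_pos (by positivity)
  have : 0 < 1 + α := by linarith
  field_simp

lemma kernel_Psi {α : ℝ} (h0 : 0 < α) (h1 : α < 1) {x : ℝ} (hx : 0 < x) :
    ∫ s in (0:ℝ)..x, (x - s) ^ (-α) * Psi α s = Real.Gamma (1 - α) / (1 + α) * x * Phi α x := by
  set K : ℕ → ℝ → ℝ := fun n s => (x - s) ^ (-α) * (s ^ α * (s ^ (1 + α)) ^ n) with hK
  set F : ℕ → ℝ → ℝ := fun n s => (1 + α) * (dC (cC α) n * K n s) with hF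
  have hKint : ∀ n, IntegrableOn (K n) (Ioc 0 x) := fun n => by
    rw [← intervalIntegrable_iff_integrableOn_Ioc_of_le hx.le]
    refine kernel_integrable h1 (Continuous.continuousOn ?_)
    exact (Real.continuous_rpow_const h0.le).mul
      ((Real.continuous_rpow_const (by linarith)).pow n)
  have hFint : ∀ n, Integrable (F n) (volume.restrict (Ioc 0 x)) := fun n =>
    ((hKint n).const_mul _).const_mul _
  have hval : ∀ n, ∫ s in Ioc 0 x, F n s =
      -(Real.Gamma (1 - α) / (1 + α) * x * (cC α n * (x ^ (1 + α)) ^ n)) := fun n => by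
    rw [← term_value h0 h1 hx n, integral_const_mul, integral_const_mul,
      intervalIntegral.integral_of_le hx.le]
  have hnorm : ∀ n, ∫ s in Ioc 0 x, ‖F n s‖ =
      |Real.Gamma (1 - α) / (1 + α) * x| * (|cC α n| * (x ^ (1 + α)) ^ n) := fun n => by
    have e : ∫ s in Ioc 0 x, ‖F n s‖ = ∫ s in Ioc 0 x, |1 + α| * (|dC (cC α) n| * K n s) := by
      refine setIntegral_congr_fun measurableSet_Ioc (fun s hs => ?_)
      have hk : 0 ≤ K n s := by
        have h2 : 0 ≤ x - s := by linarith [hs.2]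
        have h3 : 0 ≤ s := hs.1.le
        simp only [hK]
        positivity
      simp only [hF]
      rw [norm_mul, norm_mul, Real.norm_eq_abs, Real.norm_eq_abs, Real.norm_eq_abs, abs_of_nonneg hk]
    have hk : 0 ≤ ∫ s in Ioc 0 x, K n s := by
      refine setIntegral_nonneg measurableSet_Ioc (fun s hs => ?_)
      have h2 : 0 ≤ x - s := by linarith [hs.2]
      have h3 : 0 ≤ s := hs.1.le
      simp only [hK]
      positivity
    have h5 := congrArg abs (hval n)
    simp only [hF] at h5
    rw [integral_const_mul, integral_const_mul, abs_mul, abs_mul, abs_of_nonneg hk] at h5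
    rw [e, integral_const_mul, integral_const_mul, h5, abs_neg, abs_mul, abs_mul (cC α n),
      abs_of_nonneg (show 0 ≤ (x ^ (1 + α)) ^ n by positivity)]
  have hsum : Summable fun n => ∫ s in Ioc 0 x, ‖F n s‖ := by
    simp_rw [hnorm]
    exact (cC_ent h0 h1 _ (by positivity)).mul_left _
  have key := (hasSum_integral_of_summable_integral_norm hFint hsum).tsum_eq
  simp_rw [hval] at key
  rw [tsum_neg, tsum_mul_left] at key
  rw [Phi_eq, pS, intervalIntegral.integral_of_le hx.le, ← neg_inj, key, ← integral_neg]
  refine integral_congr_ae (Eventually.of_forall fun s => ?_)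
  simp only [hF, hK, Psi, pS]
  rw [mul_neg, neg_neg, ← tsum_mul_left, ← tsum_mul_left]
  refine tsum_congr (fun n => ?_)
  ring

/-- Both sign versions of the extremum principle. -/
lemma extremum {α : ℝ} (h0 : 0 < α) (h1 : α < 1) {x0 : ℝ} (hx0 : 0 < x0) (σ : ℝ)
    (h : ∀ s ∈ Ioo 0 x0, 0 ≤ σ * (Psi α s - Psi α x0)) :
    σ * (Real.Gamma (1 - α) / (1 + α) * (Phi α x0 - x0 * Psi α x0)
      - Psi α x0 * x0 ^ (-α)) ≤ 0 := by
  obtain ⟨d, hd⟩ := Psi_hasDerivAt h0 h1 hx0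
  have hcont := Psi_continuous h0 h1
  have h1a : 1 - α ≠ 0 := by linarith
  refine frac_lemma (φ := fun s => σ * (Psi α s - Psi α x0))
    (P := fun x => σ * (Real.Gamma (1 - α) / (1 + α) * (x * Phi α x)
      - Psi α x0 * x ^ (1 - α) / (1 - α))) h0 h1 hx0
    (by fun_prop) h ((hd.sub_const _).const_mul σ) (by simp) ?_ ?_
  · intro x hx
    have e : ∀ s, (x - s) ^ (-α) * (σ * (Psi α s - Psi α x0)) =
        σ * ((x - s) ^ (-α) * Psi α s - (x - s) ^ (-α) * Psi α x0) := fun s => by ring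
    simp_rw [e]
    rw [intervalIntegral.integral_const_mul, intervalIntegral.integral_sub
      (kernel_integrable h1 hcont.continuousOn) (kernel_integrable h1 continuousOn_const),
      kernel_Psi h0 h1 hx.1, kernel_const h1]
    ring
  · have h2 := ((hasDerivAt_id x0).mul (Phi_hasDerivAt h0 h1 hx0)).const_mul
      (Real.Gamma (1 - α) / (1 + α))
    have h3 := ((Real.hasDerivAt_rpow_const (x := x0) (p := 1 - α) (Or.inl hx0.ne')).const_mul
      (Psi α x0)).div_const (1 - α)
    refine ((h2.sub h3).const_mul σ).congr_deriv ?_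
    rw [show 1 - α - 1 = -α by ring]
    simp only [id]
    field_simp
    ring

lemma Phi_pos_of {α : ℝ} (h0 : 0 < α) (h1 : α < 1) {x : ℝ} (hx : 0 < x)
    (h : ∀ s ∈ Ioo 0 x, 0 < Psi α s) : 0 < Phi α x := by
  have h2 : 0 < ∫ s in (0:ℝ)..x, (x - s) ^ (-α) * Psi α s := by
    refine intervalIntegral.intervalIntegral_pos_of_pos_on
      (kernel_integrable h1 (Psi_continuous h0 h1).continuousOn) (fun s hs => ?_) hx
    exact mul_pos (Real.rpow_pos_of_pos (by linarith [hs.2]) _) (h s hs)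
  rw [kernel_Psi h0 h1 hx] at h2
  have h3 : 0 < Real.Gamma (1 - α) / (1 + α) * x :=
    mul_pos (div_pos (Real.Gamma_pos_of_pos (by linarith)) (by linarith)) hx
  exact (mul_pos_iff_of_pos_left h3).1 h2

lemma Psi_pos {α : ℝ} (h0 : 0 < α) (h1 : α < 1) {x : ℝ} (hx : 0 < x) : 0 < Psi α x := by
  by_contra hcon
  rw [not_lt] at hcon
  obtain ⟨δ, hδ, hnear⟩ := Psi_near_zero h0 h1
  have hcont := Psi_continuous h0 h1
  have hcomp : IsCompact (Icc δ x ∩ {y | Psi α y ≤ 0}) :=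
    isCompact_Icc.inter_right (isClosed_le hcont continuous_const)
  have hδx : δ ≤ x := by
    by_contra h
    exact absurd (hnear x hx (not_le.1 h)) (not_lt.2 hcon)
  obtain ⟨x1, ⟨hx1, hx1'⟩, hmin⟩ := hcomp.exists_isLeast ⟨x, ⟨hδx, le_rfl⟩, hcon⟩
  have hx1p : 0 < x1 := hδ.trans_le hx1.1
  have hpos : ∀ s ∈ Ioo 0 x1, 0 < Psi α s := by
    intro s hs
    by_contra h
    rw [not_lt] at h
    rcases lt_or_ge s δ with h2 | h2
    · exact absurd (hnear s hs.1 h2) (not_lt.2 h)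
    · exact absurd (hmin ⟨⟨h2, (hs.2.le.trans hx1.2)⟩, h⟩) (not_le.2 hs.2)
  have hPhi := Phi_pos_of h0 h1 hx1p hpos
  have hz : Psi α x1 ≤ 0 := hx1'
  have hext := extremum h0 h1 hx1p 1 (fun s hs => by
    have := hpos s hs
    linarith)
  have hG : 0 < Real.Gamma (1 - α) / (1 + α) :=
    div_pos (Real.Gamma_pos_of_pos (by linarith)) (by linarith)
  have h3 : 0 < Real.Gamma (1 - α) / (1 + α) * (Phi α x1 - x1 * Psi α x1) :=
    mul_pos hG (by nlinarith)
  have h4 : 0 ≤ -Psi α x1 * x1 ^ (-α) := mul_nonneg (by linarith) (by positivity)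
  linarith

lemma Phi_pos {α : ℝ} (h0 : 0 < α) (h1 : α < 1) {x : ℝ} (hx : 0 < x) : 0 < Phi α x :=
  Phi_pos_of h0 h1 hx (fun _ hs => Psi_pos h0 h1 hs.1)

lemma Phi_le_one {α : ℝ} (h0 : 0 < α) (h1 : α < 1) {x : ℝ} (hx : 0 < x) : Phi α x ≤ 1 := by
  have hanti : AntitoneOn (Phi α) (Ici 0) := by
    refine antitoneOn_of_deriv_nonpos (convex_Ici 0) (Phi_continuous h0 h1).continuousOn ?_ ?_
    · intro y hy
      rw [interior_Ici] at hy
      exact (Phi_hasDerivAt h0 h1 hy).differentiableAt.differentiableWithinAt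
    · intro y hy
      rw [interior_Ici] at hy
      rw [(Phi_hasDerivAt h0 h1 hy).deriv]
      linarith [Psi_pos h0 h1 hy]
  have := hanti (mem_Ici.2 le_rfl) (mem_Ici.2 hx.le) hx.le
  rwa [Phi_zero h0] at this

lemma Psi_le {α : ℝ} (h0 : 0 < α) (h1 : α < 1) {x : ℝ} (hx : 0 < x) : Psi α x ≤ 4 := by
  by_contra hcon
  rw [not_le] at hcon
  have hx4 : 1 / 4 ≤ x := by
    by_contra h
    exact absurd (Psi_small h0 hx.le (not_le.1 h).le) (not_le.2 hcon)
  obtain ⟨x0, hx0, hmax⟩ := isCompact_Icc.exists_isMaxOn (nonempty_Icc.2 hx4)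
    (Psi_continuous h0 h1).continuousOn
  have hbig : 4 < Psi α x0 := hcon.trans_le (hmax ⟨hx4, le_rfl⟩)
  have hx0p : 0 < x0 := by linarith [hx0.1]
  have hext := extremum h0 h1 hx0p (-1) (fun s hs => by
    rcases le_total s (1 / 4) with h | h
    · linarith [Psi_small h0 hs.1.le h]
    · have : Psi α s ≤ Psi α x0 := hmax ⟨h, hs.2.le.trans hx0.2⟩
      linarith)
  have hG : 0 < Real.Gamma (1 - α) / (1 + α) :=
    div_pos (Real.Gamma_pos_of_pos (by linarith)) (by linarith)
  have h4 : 0 < Psi α x0 * x0 ^ (-α) := mul_pos (by linarith) (Real.rpow_pos_of_pos hx0p _)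
  have h5 : Phi α x0 - x0 * Psi α x0 < 0 := by
    have := Phi_le_one h0 h1 hx0p
    nlinarith [hx0.1]
  have h6 := mul_neg_of_pos_of_neg hG h5
  linarith

lemma Phi_lip {α : ℝ} (h0 : 0 < α) (h1 : α < 1) {a b : ℝ} (ha : 0 ≤ a) (hb : 0 ≤ b) :
    |Phi α a - Phi α b| ≤ 4 * |a - b| := by
  wlog hab : a ≤ b generalizing a b
  · rw [abs_sub_comm, abs_sub_comm a b]
    exact this hb ha (not_le.1 hab).le
  have hc := (Phi_continuous h0 h1).continuousOn (s := Ici 0)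
  have hd : DifferentiableOn ℝ (Phi α) (interior (Ici 0)) := by
    intro y hy
    rw [interior_Ici] at hy
    exact (Phi_hasDerivAt h0 h1 hy).differentiableAt.differentiableWithinAt
  have h2 := (convex_Ici (0:ℝ)).mul_sub_le_image_sub_of_le_deriv (C := -4) hc hd (fun y hy => by
    rw [interior_Ici] at hy
    rw [(Phi_hasDerivAt h0 h1 hy).deriv]
    linarith [Psi_le h0 h1 hy]) a ha b hb hab
  have h3 := (convex_Ici (0:ℝ)).image_sub_le_mul_sub_of_deriv_le (C := 0) hc hd (fun y hy => by
    rw [interior_Ici] at hy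
    rw [(Phi_hasDerivAt h0 h1 hy).deriv]
    linarith [Psi_pos h0 h1 hy]) a ha b hb hab
  rw [abs_sub_comm a b, abs_of_nonneg (sub_nonneg.2 hab), abs_le]
  constructor <;> linarith

/-! ### Constants and the final bound -/

lemma a0_nonneg {α : ℝ} (h0 : 0 < α) (h1 : α < 1) : 0 ≤ a0 α := by
  have : 0 ≤ ∫ x in Set.Ioi (0:ℝ), Phi α x :=
    setIntegral_nonneg measurableSet_Ioi (fun x hx => (Phi_pos h0 h1 hx).le)
  rw [a0]
  positivity

lemma C1_ge {α : ℝ} (h0 : 0 < α) (h1 : α < 1) : 2 ≤ C1 α := by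
  have hint : IntervalIntegrable (fun u : ℝ => (1 - u) ^ (α - 1)) volume (1 / 2) 1 := by
    have := kernel_integrable (α := 1 - α) (x := 1) (a := 1 / 2) (b := 1) (f := fun _ => 1)
      (by linarith) continuousOn_const
    simpa using this
  have hint2 : IntervalIntegrable (fun u : ℝ => u ^ (-(1 + α)) * (1 - u) ^ (α - 1))
      volume (1 / 2) 1 := by
    refine IntervalIntegrable.continuousOn_mul hint ?_
    refine ContinuousOn.rpow_const continuousOn_id (fun u hu => Or.inl ?_)
    rw [uIcc_of_le (by norm_num)] at hu
    have := hu.1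
    linarith
  have hval : ∫ u in (1/2:ℝ)..1, (1 - u) ^ (α - 1) = (1 / 2) ^ α / α := by
    rw [intervalIntegral.integral_comp_sub_left (fun s => s ^ (α - 1)) 1,
      integral_rpow (Or.inl (by linarith)), sub_self, Real.zero_rpow (by linarith),
      show α - 1 + 1 = α by ring]
    norm_num
  have hle : (1 / 2) ^ α / α ≤ ∫ u in (1/2:ℝ)..1, u ^ (-(1+α)) * (1-u) ^ (α-1) := by
    rw [← hval]
    refine intervalIntegral.integral_mono_on (by norm_num) hint hint2 (fun u hu => ?_)
    refine le_mul_of_one_le_left (Real.rpow_nonneg (by linarith [hu.2]) _) ?_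
    exact Real.one_le_rpow_of_pos_of_le_one_of_nonpos (by linarith [hu.1]) hu.2 (by linarith)
  have hp : (0:ℝ) < 2 ^ α := by positivity
  calc (2:ℝ) = α * 2 ^ (1 + α) * ((1 / 2) ^ α / α) := by
        rw [Real.rpow_add (by norm_num), Real.rpow_one, one_div, Real.inv_rpow (by norm_num)]
        field_simp
    _ ≤ C1 α := by
        rw [C1]
        exact mul_le_mul_of_nonneg_left (hle.trans (le_max_left _ _)) (by positivity)

lemma fundSol_lip {α : ℝ} (h0 : 0 < α) (h1 : α < 1) {t : ℝ} (ht : 0 < t) (a b : ℝ) :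
    |fundSol α t a - fundSol α t b| ≤ C2 α * t ^ (-2/(1+α)) * |a - b| := by
  set τ := t ^ (-1/(1+α)) with hτ
  have hτ0 : 0 < τ := Real.rpow_pos_of_pos ht _
  have e : t ^ (-2/(1+α)) = τ * τ := by
    rw [hτ, ← Real.rpow_add ht]; congr 1; ring
  have hA := a0_nonneg h0 h1
  have hl := Phi_lip h0 h1 (a := |a| * τ) (b := |b| * τ) (by positivity) (by positivity)
  rw [← sub_mul, abs_mul, abs_of_pos hτ0] at hl
  have h3 := abs_abs_sub_abs_le_abs_sub a b
  rw [fundSol, fundSol, ← hτ, ← mul_sub, abs_mul, abs_of_nonneg (by positivity), e, C2]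
  calc a0 α * τ * |Phi α (|a| * τ) - Phi α (|b| * τ)|
      ≤ a0 α * τ * (4 * (|a - b| * τ)) := by
        gcongr
        exact hl.trans (by gcongr)
    _ = 2 * a0 α * 2 * (τ * τ) * |a - b| := by ring
    _ ≤ _ := by
        have := C1_ge h0 h1
        gcongr

lemma final_bound {α : ℝ} (h0 : 0 < α) (h1 : α < 1) {g : ℝ → ℝ}
    (hg : IntegrableOn g (Set.Ioi 0))
    (hyg : IntegrableOn (fun y => y * g y) (Set.Ioi 0)) {t : ℝ} (ht : 0 < t)
    (σ : ℝ) (hσ : |σ| = 1) (x : ℝ) :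
    ‖(∫ y in Set.Ioi (0:ℝ), fundSol α t (x + σ * y) * g y) -
          (∫ y in Set.Ioi (0:ℝ), g y) * fundSol α t x‖ ≤
      C2 α * t ^ (-2/(1+α)) * ∫ y in Set.Ioi (0:ℝ), |y * g y| := by
  have hcont : Continuous (fundSol α t) := by
    have := Phi_continuous h0 h1
    unfold fundSol
    fun_prop
  have hpt : ∀ y ∈ Ioi (0:ℝ), ‖(fundSol α t (x + σ * y) - fundSol α t x) * g y‖ ≤
      C2 α * t ^ (-2/(1+α)) * |y * g y| := by
    intro y hy
    have := fundSol_lip h0 h1 ht (x + σ * y) x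
    rw [add_sub_cancel_left, abs_mul σ, hσ, one_mul] at this
    rw [norm_mul, Real.norm_eq_abs, Real.norm_eq_abs, abs_mul, ← mul_assoc]
    gcongr
  have hpt' : ∀ᵐ y ∂(volume.restrict (Ioi (0:ℝ))),
      ‖(fundSol α t (x + σ * y) - fundSol α t x) * g y‖ ≤
      C2 α * t ^ (-2/(1+α)) * |y * g y| :=
    (ae_restrict_iff' measurableSet_Ioi).2 (Eventually.of_forall hpt)
  have hdom : Integrable (fun y => C2 α * t ^ (-2/(1+α)) * |y * g y|)
      (volume.restrict (Ioi (0:ℝ))) := hyg.abs.const_mul _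
  have hI : Integrable (fun y => (fundSol α t (x + σ * y) - fundSol α t x) * g y)
      (volume.restrict (Ioi (0:ℝ))) := by
    refine hdom.mono' ?_ hpt'
    exact (Continuous.aestronglyMeasurable (by fun_prop)).mul hg.aestronglyMeasurable
  have hI2 : Integrable (fun y => fundSol α t x * g y) (volume.restrict (Ioi (0:ℝ))) :=
    hg.const_mul _
  have e : (∫ y in Set.Ioi (0:ℝ), fundSol α t (x + σ * y) * g y) =
      (∫ y in Set.Ioi (0:ℝ), (fundSol α t (x + σ * y) - fundSol α t x) * g y) +
        (∫ y in Set.Ioi (0:ℝ), g y) * fundSol α t x := by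
    rw [mul_comm (∫ y in Set.Ioi (0:ℝ), g y), ← integral_const_mul, ← integral_add hI hI2]
    refine integral_congr_ae (Eventually.of_forall fun y => ?_)
    simp only
    ring
  rw [e, add_sub_cancel_right]
  refine (norm_integral_le_of_norm_le hdom hpt').trans (le_of_eq ?_)
  rw [integral_const_mul]

/-- `L^∞` bounds: `‖v^± (·,t) − m·𝔈_t‖_{L^∞(0,∞)} ≤ C₂(α) t^{−2/(1+α)} ‖y g(y)‖_{L¹}`. -/
theorem stmt11 (α : ℝ) (hα : α ∈ Set.Ioo (0:ℝ) 1) (g : ℝ → ℝ)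
    (hg : IntegrableOn g (Set.Ioi 0))
    (hyg : IntegrableOn (fun y => y * g y) (Set.Ioi 0))
    (hsupp : HasCompactSupport g)
    (t : ℝ) (ht : 1 < t) :
    eLpNorm (fun x => (∫ y in Set.Ioi (0:ℝ), fundSol α t (x + y) * g y) -
          (∫ y in Set.Ioi (0:ℝ), g y) * fundSol α t x) ⊤ (volume.restrict (Set.Ioi 0)) ≤
        ENNReal.ofReal (C2 α * t ^ (-2/(1+α)) * ∫ y in Set.Ioi (0:ℝ), |y * g y|) ∧
      eLpNorm (fun x => (∫ y in Set.Ioi (0:ℝ), fundSol α t (x - y) * g y) -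
          (∫ y in Set.Ioi (0:ℝ), g y) * fundSol α t x) ⊤ (volume.restrict (Set.Ioi 0)) ≤
        ENNReal.ofReal (C2 α * t ^ (-2/(1+α)) * ∫ y in Set.Ioi (0:ℝ), |y * g y|) := by
  have h0 := hα.1
  have h1 := hα.2
  have ht0 : 0 < t := by linarith
  rw [eLpNorm_exponent_top, eLpNorm_exponent_top]
  constructor
  · refine eLpNormEssSup_le_of_ae_bound (Eventually.of_forall fun x => ?_)
    have := final_bound h0 h1 hg hyg ht0 1 (by simp) x
    simpa only [one_mul] using this
  · refine eLpNormEssSup_le_of_ae_bound (Eventually.of_forall fun x => ?_)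
    have := final_bound h0 h1 hg hyg ht0 (-1) (by simp) x
    simpa only [neg_mul, one_mul, ← sub_eq_add_neg] using this
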